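/- Let A = diag(a₁₁, …, a_NN), B = diag(b₁₁, …, b_NN), C = diag(c₁₁, …, c_NN), D = diag(d₁₁, …, d_NN) be real diagonal N×N matrices with a_jj·d_jj − b_jj·c_jj = 1 and b_jj ≠ 0 for each j, so that M = [[A,B],[C,D]] is a free symplectic matrix. Let f, g : ℝᴺ → ℂ be Schwartz functions. Then the FMT with matrix M (which is the N-dimensional separable linear canonical transform F_{(A,B,C,D)}) satisfies: the FMT of t ↦ ∫_{ℝᴺ} f(τ) g(t θ τ) dτ equals F_{(A,B,C,D)}[f](u) · F_{(A,B,C,D)}[g](u) for every u ∈ ℝᴺ, where g(t θ τ) is the M-generalized translation of g. -/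

import Mathlib

open MeasureTheory Matrix Complex

/-- The free metaplectic transform (FMT) of `f : ℝᴺ → ℂ` with respect to the blocks
`A`, `B`, `D` of a free symplectic matrix `M = [[A,B],[C,D]]`:
`L_M[f](u) = |det B|^(−1/2) ∫ f(t) · exp(πi(u D B⁻¹ uᵀ + t B⁻¹ A tᵀ) − 2πi t B⁻¹ uᵀ) dt`. -/
noncomputable def fmt {N : ℕ} (A B D : Matrix (Fin N) (Fin N) ℝ)
    (f : (Fin N → ℝ) → ℂ) (u : Fin N → ℝ) : ℂ :=
  (((Real.sqrt |B.det|)⁻¹ : ℝ) : ℂ) *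
    ∫ t : Fin N → ℝ,
      f t * Complex.exp (↑Real.pi * Complex.I *
          (↑(u ⬝ᵥ ((D * B⁻¹) *ᵥ u)) + ↑(t ⬝ᵥ ((B⁻¹ * A) *ᵥ t)))
        - 2 * ↑Real.pi * Complex.I * ↑(t ⬝ᵥ (B⁻¹ *ᵥ u)))

/-- The `M`-generalized translation of `g` by `τ`:
`g(t θ τ) = |det B|⁻¹ ∫ L_M[g](u) · exp(πi(τ B⁻¹ A τᵀ − t B⁻¹ A tᵀ) + 2πi (t−τ) B⁻¹ uᵀ) du`. -/
noncomputable def genTrans {N : ℕ} (A B D : Matrix (Fin N) (Fin N) ℝ)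
    (g : (Fin N → ℝ) → ℂ) (t τ : Fin N → ℝ) : ℂ :=
  ((|B.det|⁻¹ : ℝ) : ℂ) *
    ∫ u : Fin N → ℝ,
      fmt A B D g u * Complex.exp (↑Real.pi * Complex.I *
          (↑(τ ⬝ᵥ ((B⁻¹ * A) *ᵥ τ)) - ↑(t ⬝ᵥ ((B⁻¹ * A) *ᵥ t)))
        + 2 * ↑Real.pi * Complex.I * ↑((t - τ) ⬝ᵥ (B⁻¹ *ᵥ u)))

open FourierTransform SchwartzMap

/-- A complex exponential with purely imaginary frequency has temperate growth. -/
theorem hasTemperateGrowth_cexp_mul_I (c : ℝ) :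
    Function.HasTemperateGrowth (fun r : ℝ => cexp (c * I * r)) := by
  refine ⟨(contDiff_const.mul ofRealCLM.contDiff).cexp, fun n => ⟨0, |c| ^ n, fun x => ?_⟩⟩
  have key : ∀ n : ℕ, iteratedDeriv n (fun r : ℝ => cexp (c * I * r)) =
      fun r : ℝ => (c * I) ^ n * cexp (c * I * r) := by
    intro n
    induction n with
    | zero => simp
    | succ n ih =>
      rw [iteratedDeriv_succ, ih]
      ext x
      have h : HasDerivAt (fun r : ℝ => (c * I) ^ n * cexp (c * I * r))
          ((c * I) ^ n * (cexp (c * I * x) * (c * I * 1))) x :=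
        (((hasDerivAt_id x).ofReal_comp.const_mul (c * I)).cexp).const_mul _
      rw [h.deriv]
      ring
  have hx : ‖cexp (c * I * x)‖ = 1 := by
    rw [show (c * I * x : ℂ) = ((c * x : ℝ) : ℂ) * I by push_cast; ring, norm_exp_ofReal_mul_I]
  rw [norm_iteratedFDeriv_eq_norm_iteratedDeriv, key]
  simp [hx]

/-- The diagonal quadratic form with coefficients `w`. -/
noncomputable def diagQuad {N : ℕ} (w : Fin N → ℝ) (x : EuclideanSpace ℝ (Fin N)) : ℝ :=
  ∑ j, w j * x j ^ 2

theorem hasTemperateGrowth_diagQuad {N : ℕ} (w : Fin N → ℝ) :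
    Function.HasTemperateGrowth (diagQuad w) := by
  have h : ∀ j, Function.HasTemperateGrowth (fun x : EuclideanSpace ℝ (Fin N) => x j) :=
    fun j => (EuclideanSpace.proj (𝕜 := ℝ) j).hasTemperateGrowth
  unfold diagQuad
  fun_prop

/-- The chirp `exp(πi ∑ⱼ wⱼ xⱼ²)`. -/
noncomputable def chirp {N : ℕ} (w : Fin N → ℝ) (x : EuclideanSpace ℝ (Fin N)) : ℂ :=
  cexp (Real.pi * I * (diagQuad w x : ℝ))

theorem hasTemperateGrowth_chirp {N : ℕ} (w : Fin N → ℝ) :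
    Function.HasTemperateGrowth (chirp w) :=
  (hasTemperateGrowth_cexp_mul_I Real.pi).comp (hasTemperateGrowth_diagQuad w)

theorem chirp_mul_cexp_neg {N : ℕ} (w : Fin N → ℝ) (x : EuclideanSpace ℝ (Fin N)) :
    chirp w x * cexp (-(Real.pi * I * (diagQuad w x : ℝ))) = 1 := by
  rw [chirp, ← Complex.exp_add, add_neg_cancel, Complex.exp_zero]

/-- A Schwartz function on `Fin N → ℝ`, seen on Euclidean space and multiplied by a chirp. -/
noncomputable def chirpMul {N : ℕ} (w : Fin N → ℝ) (f : 𝓢(Fin N → ℝ, ℂ)) :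
    𝓢(EuclideanSpace ℝ (Fin N), ℂ) :=
  smulLeftCLM ℂ (chirp w) (compCLMOfContinuousLinearEquiv ℂ (EuclideanSpace.equiv (Fin N) ℝ) f)

theorem chirpMul_apply {N : ℕ} (w : Fin N → ℝ) (f : 𝓢(Fin N → ℝ, ℂ))
    (x : EuclideanSpace ℝ (Fin N)) : chirpMul w f x = chirp w x * f x.ofLp := by
  rw [chirpMul, smulLeftCLM_apply_apply (hasTemperateGrowth_chirp w)]
  rfl

theorem integral_euclideanSpace_ofLp {N : ℕ} (φ : EuclideanSpace ℝ (Fin N) → ℂ) :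
    ∫ x, φ x = ∫ t : Fin N → ℝ, φ (WithLp.toLp 2 t) :=
  ((PiLp.volume_preserving_toLp (Fin N)).integral_comp
    (MeasurableEquiv.toLp 2 _).measurableEmbedding φ).symm

theorem integral_eq_abs_det_diagonal_mul {N : ℕ} {b : Fin N → ℝ} (hb : ∀ j, b j ≠ 0)
    (φ : (Fin N → ℝ) → ℂ) :
    ∫ u, φ u = ((|(diagonal b).det| : ℝ) : ℂ) * ∫ v, φ (b * v) := by
  have hdet : (diagonal b).det ≠ 0 := by
    rw [det_diagonal]
    exact Finset.prod_ne_zero_iff.2 fun j _ => hb j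
  let e : (Fin N → ℝ) ≃ᵐ (Fin N → ℝ) :=
    MeasurableEquiv.piCongrRight fun j => MeasurableEquiv.mulLeft₀ (b j) (hb j)
  have he : ⇑(toLin' (diagonal b)) = e := by
    ext v j
    simp [e, mulVec_diagonal, MeasurableEquiv.piCongrRight, Equiv.piCongrRight]
  conv_lhs => rw [← Real.smul_map_diagonal_volume_pi hdet]
  rw [integral_smul_measure, he, e.measurableEmbedding.integral_map,
    ENNReal.toReal_ofReal (abs_nonneg _), Complex.real_smul]
  rfl

theorem inv_diagonal_of_ne_zero {N : ℕ} {b : Fin N → ℝ} (hb : ∀ j, b j ≠ 0) :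
    (diagonal b)⁻¹ = diagonal (b⁻¹) := by
  refine inv_eq_right_inv ?_
  rw [diagonal_mul_diagonal, ← diagonal_one]
  congr 1
  ext j
  simp [hb j]

theorem dotProduct_diagonal_mulVec_self {N : ℕ} (w : Fin N → ℝ) (t : Fin N → ℝ) :
    t ⬝ᵥ (diagonal w *ᵥ t) = diagQuad w (WithLp.toLp 2 t) := by
  simp only [dotProduct, mulVec_diagonal, diagQuad]
  exact Finset.sum_congr rfl fun j _ => by ring

/-- The diagonal transform is a rescaled Fourier transform, with a chirp inside and outside. -/
theorem fmt_diagonal {N : ℕ} (a : Fin N → ℝ) {b : Fin N → ℝ} (d : Fin N → ℝ)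
    (hb : ∀ j, b j ≠ 0) (f : (Fin N → ℝ) → ℂ) (v : EuclideanSpace ℝ (Fin N)) :
    fmt (diagonal a) (diagonal b) (diagonal d) f (b * v.ofLp) =
      (((Real.sqrt |(diagonal b).det|)⁻¹ : ℝ) : ℂ) * chirp (d * b) v *
        𝓕 (fun x : EuclideanSpace ℝ (Fin N) => chirp (b⁻¹ * a) x * f x.ofLp) v := by
  rw [fmt, inv_diagonal_of_ne_zero hb, Real.fourier_eq',
    integral_euclideanSpace_ofLp, mul_assoc (Complex.ofReal _),
    ← integral_const_mul (chirp (d * b) v)]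
  congr 2
  ext t
  have h1 : (b * v.ofLp) ⬝ᵥ ((diagonal d * diagonal b⁻¹) *ᵥ (b * v.ofLp)) =
      diagQuad (d * b) v := by
    rw [diagonal_mul_diagonal, dotProduct_diagonal_mulVec_self]
    refine Finset.sum_congr rfl fun j _ => ?_
    have := hb j
    simp
    field_simp
  have h2 : t ⬝ᵥ ((diagonal b⁻¹ * diagonal a) *ᵥ t) =
      diagQuad (b⁻¹ * a) (WithLp.toLp 2 t) := by
    rw [diagonal_mul_diagonal, dotProduct_diagonal_mulVec_self]
    rfl
  have h3 : t ⬝ᵥ (diagonal b⁻¹ *ᵥ (b * v.ofLp)) = inner ℝ (WithLp.toLp 2 t) v := by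
    simp only [dotProduct, mulVec_diagonal, PiLp.inner_apply]
    refine Finset.sum_congr rfl fun j _ => ?_
    have := hb j
    simp
    field_simp
  rw [h1, h2, h3, chirp, chirp, smul_eq_mul,
    show ∀ x y z w : ℂ, x * (y * (z * w)) = w * (x * z * y) by intros; ring,
    ← Complex.exp_add, ← Complex.exp_add]
  congr 2
  push_cast
  ring

/-- The diagonal transform of a Schwartz function, as a Schwartz function of the rescaled
variable. -/
noncomputable def fmtSchwartz {N : ℕ} (a b d : Fin N → ℝ) (g : 𝓢(Fin N → ℝ, ℂ)) :
    𝓢(EuclideanSpace ℝ (Fin N), ℂ) :=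
  (((Real.sqrt |(diagonal b).det|)⁻¹ : ℝ) : ℂ) •
    smulLeftCLM ℂ (chirp (d * b)) (𝓕 (chirpMul (b⁻¹ * a) g))

theorem fmt_diagonal_schwartz {N : ℕ} (a : Fin N → ℝ) {b : Fin N → ℝ} (d : Fin N → ℝ)
    (hb : ∀ j, b j ≠ 0) (g : 𝓢(Fin N → ℝ, ℂ)) (v : EuclideanSpace ℝ (Fin N)) :
    fmt (diagonal a) (diagonal b) (diagonal d) g (b * v.ofLp) = fmtSchwartz a b d g v := by
  rw [fmt_diagonal a d hb, fmtSchwartz, _root_.smul_apply,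
    smulLeftCLM_apply_apply (hasTemperateGrowth_chirp _), fourier_coe, smul_eq_mul, smul_eq_mul,
    mul_assoc]
  simp only [funext (chirpMul_apply (b⁻¹ * a) g)]

/-- The Schwartz function whose translates give the generalized translations of `g`. -/
noncomputable def genTransKernel {N : ℕ} (a b d : Fin N → ℝ) (g : 𝓢(Fin N → ℝ, ℂ)) :
    𝓢(EuclideanSpace ℝ (Fin N), ℂ) :=
  𝓕⁻ (fmtSchwartz a b d g)

/-- The generalized translation is an ordinary translation conjugated by chirps. -/
theorem genTrans_diagonal {N : ℕ} (a : Fin N → ℝ) {b : Fin N → ℝ} (d : Fin N → ℝ)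
    (hb : ∀ j, b j ≠ 0) (g : 𝓢(Fin N → ℝ, ℂ)) (x y : EuclideanSpace ℝ (Fin N)) :
    genTrans (diagonal a) (diagonal b) (diagonal d) g x.ofLp y.ofLp =
      chirp (b⁻¹ * a) y * cexp (-(Real.pi * I * (diagQuad (b⁻¹ * a) x : ℝ))) *
        genTransKernel a b d g (x - y) := by
  have hdet : ((|(diagonal b).det| : ℝ) : ℂ) ≠ 0 := by
    rw [Complex.ofReal_ne_zero, abs_ne_zero, det_diagonal]
    exact Finset.prod_ne_zero_iff.2 fun j _ => hb j
  rw [genTrans, integral_eq_abs_det_diagonal_mul hb, Complex.ofReal_inv,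
    inv_mul_cancel_left₀ hdet, genTransKernel, fourierInv_coe, Real.fourierInv_eq',
    integral_euclideanSpace_ofLp, ← integral_const_mul]
  congr 1
  ext t
  have h2 : ∀ z : EuclideanSpace ℝ (Fin N),
      z.ofLp ⬝ᵥ ((diagonal b⁻¹ * diagonal a) *ᵥ z.ofLp) = diagQuad (b⁻¹ * a) z := by
    intro z
    rw [diagonal_mul_diagonal, dotProduct_diagonal_mulVec_self]
    rfl
  have h3 : (x.ofLp - y.ofLp) ⬝ᵥ (diagonal b⁻¹ *ᵥ (b * t)) =
      inner ℝ (WithLp.toLp 2 t) (x - y) := by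
    simp only [dotProduct, mulVec_diagonal, PiLp.inner_apply]
    refine Finset.sum_congr rfl fun j _ => ?_
    have := hb j
    simp
    field_simp
    simp
  rw [inv_diagonal_of_ne_zero hb, h2, h2, h3, ← fmt_diagonal_schwartz a d hb, chirp, smul_eq_mul,
    show ∀ x y z w : ℂ, x * y * (z * w) = w * (x * y * z) by intros; ring,
    ← Complex.exp_add, ← Complex.exp_add]
  congr 2
  push_cast
  ring

/-- The generalized convolution is an ordinary convolution conjugated by chirps. -/
theorem chirp_mul_integral_mul_genTrans {N : ℕ} (a : Fin N → ℝ) {b : Fin N → ℝ} (d : Fin N → ℝ)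
    (hb : ∀ j, b j ≠ 0) (f g : 𝓢(Fin N → ℝ, ℂ)) (x : EuclideanSpace ℝ (Fin N)) :
    chirp (b⁻¹ * a) x * ∫ τ : Fin N → ℝ,
        f τ * genTrans (diagonal a) (diagonal b) (diagonal d) g x.ofLp τ =
      MeasureTheory.convolution (chirpMul (b⁻¹ * a) f) (genTransKernel a b d g)
        (ContinuousLinearMap.mul ℂ ℂ) volume x := by
  rw [MeasureTheory.convolution, integral_euclideanSpace_ofLp, ← integral_const_mul]
  congr 1
  ext τ
  have h := genTrans_diagonal a d hb g x (WithLp.toLp 2 τ)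
  rw [show (WithLp.toLp 2 τ).ofLp = τ from rfl] at h
  rw [h, ContinuousLinearMap.mul_apply', chirpMul_apply]
  linear_combination (chirp (b⁻¹ * a) (WithLp.toLp 2 τ) * f τ *
    genTransKernel a b d g (x - WithLp.toLp 2 τ)) * chirp_mul_cexp_neg (b⁻¹ * a) x

/-- Convolution theorem of the first kind for the N-dimensional
separable linear canonical transform: with `A, B, C, D` diagonal,
`aⱼⱼ dⱼⱼ − bⱼⱼ cⱼⱼ = 1` and `bⱼⱼ ≠ 0`, the FMT of
`t ↦ ∫ f(τ) g(t θ τ) dτ` equals `F_{(A,B,C,D)}[f](u) · F_{(A,B,C,D)}[g](u)`. -/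
theorem lct_convolution_first_kind {N : ℕ} (a b c d : Fin N → ℝ)
    (habcd : ∀ j, a j * d j - b j * c j = 1) (hb : ∀ j, b j ≠ 0)
    (f g : SchwartzMap ((Fin N) → ℝ) ℂ) (u : Fin N → ℝ) :
    fmt (Matrix.diagonal a) (Matrix.diagonal b) (Matrix.diagonal d)
        (fun t => ∫ τ : Fin N → ℝ,
          f τ * genTrans (Matrix.diagonal a) (Matrix.diagonal b)
            (Matrix.diagonal d) (⇑g) t τ) u
      = fmt (Matrix.diagonal a) (Matrix.diagonal b) (Matrix.diagonal d) (⇑f) u *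
        fmt (Matrix.diagonal a) (Matrix.diagonal b) (Matrix.diagonal d) (⇑g) u := by
  obtain ⟨v, rfl⟩ : ∃ v : EuclideanSpace ℝ (Fin N), b * v.ofLp = u := by
    refine ⟨WithLp.toLp 2 (b⁻¹ * u), ?_⟩
    ext j
    simp [hb j]
  rw [fmt_diagonal_schwartz a d hb g, fmt_diagonal a d hb, fmt_diagonal a d hb]
  simp only [chirp_mul_integral_mul_genTrans a d hb, ← chirpMul_apply]
  rw [Real.fourier_mul_convolution_eq (chirpMul _ f).integrable
    (genTransKernel a b d g).integrable,
    ← fourier_coe (genTransKernel a b d g), genTransKernel,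
    FourierTransform.fourier_fourierInv_eq]
  exact (mul_assoc _ _ _).symm
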